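/- arXiv:0909.1817 — 4 statements merged into one kernel-verified Lean document; each statement's English description precedes it below -/
import Mathlib

section
/- For all P₁, P₂ ≥ 0 and every ρ ∈ ℂ, the determinant det(I_N + H Q_r(ρ) H†) is real and equals 1 + P₁‖h₁‖² + P₂‖h₂‖² + (1 − |ρ|²) P₁P₂ det(H†H) + 2√(P₁P₂) · Re(conj(ρ) · (h₁†h₂)). -/
open Matrix Complex Filter

/-- The `N × 2` matrix with columns `h₁` and `h₂`. -/
noncomputable def Hm {N : ℕ} (h₁ h₂ : Fin N → ℂ) : Matrix (Fin N) (Fin 2) ℂ :=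
  Matrix.of fun i j => if j = 0 then h₁ i else h₂ i

/-- The Hermitian inner product `h₁† h₂ = ∑ i, conj (h₁ i) * h₂ i`. -/
noncomputable def ip {N : ℕ} (h₁ h₂ : Fin N → ℂ) : ℂ :=
  ∑ i, (starRingEnd ℂ) (h₁ i) * h₂ i

/-- The squared Euclidean norm `‖h‖²`. -/
noncomputable def nsq {N : ℕ} (h : Fin N → ℂ) : ℝ :=
  ∑ i, Complex.normSq (h i)

/-- `det (H† H)`, a nonnegative real number (taken via the real part). -/
noncomputable def detHH {N : ℕ} (h₁ h₂ : Fin N → ℂ) : ℝ :=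
  (((Hm h₁ h₂)ᴴ * Hm h₁ h₂).det).re

/-- The relay covariance matrix `Q_r(ρ)` with diagonal `P₁, P₂` and
off-diagonal `ρ √(P₁ P₂)`. -/
noncomputable def Qr (P₁ P₂ : ℝ) (ρ : ℂ) : Matrix (Fin 2) (Fin 2) ℂ :=
  !![(P₁ : ℂ), ρ * (Real.sqrt (P₁ * P₂) : ℂ);
     (starRingEnd ℂ) ρ * (Real.sqrt (P₁ * P₂) : ℂ), (P₂ : ℂ)]

/-- `det (I_N + H Q_r(ρ) H†)` (a real number, taken via the real part). -/
noncomputable def MACdet {N : ℕ} (h₁ h₂ : Fin N → ℂ) (P₁ P₂ : ℝ) (ρ : ℂ) : ℝ :=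
  ((1 + Hm h₁ h₂ * Qr P₁ P₂ ρ * (Hm h₁ h₂)ᴴ).det).re

/-- The Gram matrix `H† H` in terms of norms and the inner product. -/
theorem Hm_conjTranspose_mul_self {N : ℕ} (h₁ h₂ : Fin N → ℂ) :
    (Hm h₁ h₂)ᴴ * Hm h₁ h₂ =
      !![(nsq h₁ : ℂ), ip h₁ h₂; (starRingEnd ℂ) (ip h₁ h₂), (nsq h₂ : ℂ)] := by
  ext i j
  fin_cases i <;> fin_cases j <;>
    simp [Matrix.mul_apply, Hm, nsq, ip, Complex.normSq_eq_conj_mul_self, mul_comm]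

/-- `det (H† H) = ‖h₁‖² ‖h₂‖² - |h₁† h₂|²`. -/
theorem detHH_eq {N : ℕ} (h₁ h₂ : Fin N → ℂ) :
    detHH h₁ h₂ = nsq h₁ * nsq h₂ - Complex.normSq (ip h₁ h₂) := by
  rw [detHH, Hm_conjTranspose_mul_self, Matrix.det_fin_two_of, Complex.mul_conj]
  norm_cast

/-- For all `P₁, P₂ ≥ 0` and every `ρ ∈ ℂ`, the determinant
`det (I_N + H Q_r(ρ) H†)` is real and equals
`1 + P₁‖h₁‖² + P₂‖h₂‖² + (1 − |ρ|²) P₁ P₂ det(H†H) + 2√(P₁P₂)·Re(conj ρ · h₁†h₂)`. -/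
theorem stmt0 {N : ℕ} (hN : 0 < N) (h₁ h₂ : Fin N → ℂ) (P₁ P₂ : ℝ)
    (hP₁ : 0 ≤ P₁) (hP₂ : 0 ≤ P₂) (ρ : ℂ) :
    (1 + Hm h₁ h₂ * Qr P₁ P₂ ρ * (Hm h₁ h₂)ᴴ).det =
      ((1 + P₁ * nsq h₁ + P₂ * nsq h₂
          + (1 - ‖ρ‖ ^ 2) * (P₁ * P₂) * detHH h₁ h₂
          + 2 * Real.sqrt (P₁ * P₂) * ((starRingEnd ℂ) ρ * ip h₁ h₂).re : ℝ) : ℂ) := by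
  have hs : (Real.sqrt (P₁ * P₂) : ℂ) ^ 2 = P₁ * P₂ := by
    exact_mod_cast Real.sq_sqrt (mul_nonneg hP₁ hP₂)
  have hre : (2 : ℂ) * (((starRingEnd ℂ) ρ * ip h₁ h₂).re : ℂ) =
      (starRingEnd ℂ) ρ * ip h₁ h₂ + ρ * (starRingEnd ℂ) (ip h₁ h₂) := by
    simpa using (Complex.add_conj ((starRingEnd ℂ) ρ * ip h₁ h₂)).symm
  rw [Matrix.mul_assoc, Matrix.det_one_add_mul_comm, Matrix.mul_assoc,
    Hm_conjTranspose_mul_self, detHH_eq, ← Complex.normSq_eq_norm_sq, Qr, Matrix.det_fin_two]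
  simp only [Matrix.mul_fin_two, Matrix.add_apply, Matrix.one_apply, Matrix.of_apply,
    Matrix.cons_val', Matrix.cons_val_zero, Matrix.cons_val_one, Matrix.cons_val_fin_one]
  push_cast
  rw [mul_right_comm 2, hre, Complex.normSq_eq_conj_mul_self, Complex.normSq_eq_conj_mul_self]
  linear_combination (-(ρ * (starRingEnd ℂ) ρ) *
    (nsq h₁ * nsq h₂ - ip h₁ h₂ * (starRingEnd ℂ) (ip h₁ h₂))) * hs
end

section
/- Fix P₁, P₂ ≥ 0 and t ≥ 0. For every ρ ∈ ℂ with |ρ| = t, one has det(I_N + H Q_r(ρ) H†) ≤ det(I_N + H Q_r(ρ₀) H†), where ρ₀ = t · e^{i·arg(h₁†h₂)} (with the convention e^{i·arg(0)} = 1). In other words, for fixed magnitude of correlation, the determinant is maximized when the phase of ρ equals the phase of h₁†h₂. -/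
open Matrix Complex Filter

/-- The determinant depends on the phase of `ρ` only through `Re (conj (h₁† h₂) ρ)`. -/
theorem MACdet_eq {N : ℕ} (h₁ h₂ : Fin N → ℂ) (P₁ P₂ : ℝ) (ρ : ℂ) :
    MACdet h₁ h₂ P₁ P₂ ρ =
      1 + nsq h₁ * P₁ + nsq h₂ * P₂
        + 2 * √(P₁ * P₂) * ((starRingEnd ℂ) (ip h₁ h₂) * ρ).re
        + (nsq h₁ * nsq h₂ - ‖ip h₁ h₂‖ ^ 2) * (P₁ * P₂ - ‖ρ‖ ^ 2 * √(P₁ * P₂) ^ 2) := by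
  rw [MACdet, Matrix.mul_assoc, Matrix.det_one_add_mul_comm, Matrix.mul_assoc,
    Hm_conjTranspose_mul_self, Qr, Matrix.det_fin_two, ← Complex.normSq_eq_norm_sq,
    ← Complex.normSq_eq_norm_sq]
  simp [Complex.normSq_apply]
  ring

theorem re_conj_mul_norm_mul_exp_arg (z : ℂ) (t : ℝ) :
    ((starRingEnd ℂ) z * ((t : ℂ) * Complex.exp (Complex.I * (z.arg : ℂ)))).re = t * ‖z‖ := by
  have hz : (starRingEnd ℂ) z * Complex.exp (Complex.I * (z.arg : ℂ)) = ‖z‖ := by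
    by_cases h : z = 0
    · simp [h]
    rw [mul_comm Complex.I]
    have hn : (‖z‖ : ℂ) ≠ 0 := by simpa using h
    apply mul_left_cancel₀ hn
    calc (‖z‖ : ℂ) * ((starRingEnd ℂ) z * Complex.exp (z.arg * Complex.I))
        = (starRingEnd ℂ) z * (‖z‖ * Complex.exp (z.arg * Complex.I)) := by ring
      _ = ‖z‖ * ‖z‖ := by
        rw [Complex.norm_mul_exp_arg_mul_I, Complex.conj_mul', sq]
  rw [mul_left_comm, hz, ← Complex.ofReal_mul, Complex.ofReal_re]

/-- For fixed magnitude of correlation `|ρ| = t`, the determinant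
`det (I_N + H Q_r(ρ) H†)` is maximized when the phase of `ρ` equals the phase of `h₁†h₂`,
i.e. at `ρ₀ = t · e^{i·arg(h₁†h₂)}` (with `e^{i·arg 0} = 1` since `arg 0 = 0`). -/
theorem stmt1 {N : ℕ} (hN : 0 < N) (h₁ h₂ : Fin N → ℂ) (P₁ P₂ t : ℝ)
    (hP₁ : 0 ≤ P₁) (hP₂ : 0 ≤ P₂) (ht : 0 ≤ t)
    (ρ : ℂ) (hρ : ‖ρ‖ = t) :
    MACdet h₁ h₂ P₁ P₂ ρ ≤
      MACdet h₁ h₂ P₁ P₂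
        ((t : ℂ) * Complex.exp (Complex.I * ((ip h₁ h₂).arg : ℂ))) := by
  have hnorm : ‖(t : ℂ) * Complex.exp (Complex.I * ((ip h₁ h₂).arg : ℂ))‖ = t := by
    rw [norm_mul, Complex.norm_exp_I_mul_ofReal, mul_one, Complex.norm_of_nonneg ht]
  have hre : ((starRingEnd ℂ) (ip h₁ h₂) * ρ).re ≤ t * ‖ip h₁ h₂‖ := by
    refine (Complex.re_le_norm _).trans_eq ?_
    rw [norm_mul, Complex.norm_conj, hρ, mul_comm]
  rw [MACdet_eq, MACdet_eq, hnorm, hρ, re_conj_mul_norm_mul_exp_arg]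
  gcongr
end

section
/- (SNR increase from optimal correlation.) Assume P₁ > 0 and P₂ > 0, and let Δ = (max over ρ ∈ ℂ with |ρ| ≤ 1 of det(I_N + H Q_r(ρ) H†)) − det(I_N + H diag(P₁,P₂) H†). Then: (i) if det(H†H) > 0 and |h₁†h₂| ≤ √(P₁P₂)·det(H†H), then Δ = |h₁†h₂|² / det(H†H); (ii) if det(H†H) = 0, then Δ = 2√(P₁P₂)·|h₁†h₂|. -/
open Matrix Complex Filter

theorem MACdet_sub_zero {N : ℕ} (h₁ h₂ : Fin N → ℂ) (P₁ P₂ : ℝ) (ρ : ℂ) :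
    MACdet h₁ h₂ P₁ P₂ ρ - MACdet h₁ h₂ P₁ P₂ 0 =
      2 * Real.sqrt (P₁ * P₂) * (ρ * (starRingEnd ℂ) (ip h₁ h₂)).re
        - Real.sqrt (P₁ * P₂) ^ 2 * detHH h₁ h₂ * ‖ρ‖ ^ 2 := by
  have h01 : ((Hm h₁ h₂)ᴴ * Hm h₁ h₂) 0 1 = ip h₁ h₂ := by
    simp [Matrix.mul_apply, Hm, ip]
  have hherm : ((Hm h₁ h₂)ᴴ * Hm h₁ h₂).IsHermitian := isHermitian_conjTranspose_mul_self _
  have h10 := hherm.apply 1 0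
  have h00 := hherm.apply 0 0
  have h11 := hherm.apply 1 1
  unfold MACdet detHH
  rw [Matrix.mul_assoc (Hm h₁ h₂) (Qr P₁ P₂ ρ), Matrix.mul_assoc (Hm h₁ h₂) (Qr P₁ P₂ 0),
    det_one_add_mul_comm, det_one_add_mul_comm (Hm h₁ h₂), Matrix.mul_assoc, Matrix.mul_assoc]
  generalize (Hm h₁ h₂)ᴴ * Hm h₁ h₂ = G at *
  rw [h01] at h10
  rw [← Complex.normSq_eq_norm_sq, Complex.normSq_apply]
  have e00 := congrArg Complex.im h00
  have e11 := congrArg Complex.im h11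
  simp only [RCLike.star_def, Complex.conj_im] at e00 e11
  have i00 : (G 0 0).im = 0 := by linarith
  have i11 : (G 1 1).im = 0 := by linarith
  simp only [det_fin_two, Matrix.add_apply, Matrix.mul_apply, Fin.sum_univ_two, Qr, of_apply,
    cons_val', cons_val_zero, cons_val_one, cons_val_fin_one, h01, ← h10, Matrix.one_apply]
  simp [i00, i11]
  ring

/-- SNR increase from optimal correlation. Let `m` be the maximum of
`det (I_N + H Q_r(ρ) H†)` over `|ρ| ≤ 1`, and `Δ = m − det (I_N + H diag(P₁,P₂) H†)`
(note `Q_r(0) = diag(P₁,P₂)`). Then (i) if `det(H†H) > 0` and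
`|h₁†h₂| ≤ √(P₁P₂)·det(H†H)`, `Δ = |h₁†h₂|²/det(H†H)`; (ii) if `det(H†H) = 0`,
`Δ = 2√(P₁P₂)·|h₁†h₂|`. -/
theorem stmt7 {N : ℕ} (hN : 0 < N) (h₁ h₂ : Fin N → ℂ) (P₁ P₂ : ℝ)
    (hP₁ : 0 < P₁) (hP₂ : 0 < P₂) (m : ℝ)
    (hm : IsGreatest {x : ℝ | ∃ ρ : ℂ, ‖ρ‖ ≤ 1 ∧ x = MACdet h₁ h₂ P₁ P₂ ρ} m) :
    (0 < detHH h₁ h₂ → ‖ip h₁ h₂‖ ≤ Real.sqrt (P₁ * P₂) * detHH h₁ h₂ →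
      m - MACdet h₁ h₂ P₁ P₂ 0 = ‖ip h₁ h₂‖ ^ 2 / detHH h₁ h₂) ∧
    (detHH h₁ h₂ = 0 →
      m - MACdet h₁ h₂ P₁ P₂ 0 = 2 * Real.sqrt (P₁ * P₂) * ‖ip h₁ h₂‖) := by
  have key := MACdet_sub_zero h₁ h₂ P₁ P₂
  have hs : 0 < Real.sqrt (P₁ * P₂) := Real.sqrt_pos.2 (mul_pos hP₁ hP₂)
  obtain ⟨⟨ρ₀, hρ₀, rfl⟩, hub⟩ := hm
  have hmax : ∀ ρ : ℂ, ‖ρ‖ ≤ 1 → MACdet h₁ h₂ P₁ P₂ ρ ≤ MACdet h₁ h₂ P₁ P₂ ρ₀ :=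
    fun ρ hρ => hub ⟨ρ, hρ, rfl⟩
  have hre : (ρ₀ * (starRingEnd ℂ) (ip h₁ h₂)).re ≤ ‖ρ₀‖ * ‖ip h₁ h₂‖ := by
    simpa using Complex.re_le_norm (ρ₀ * (starRingEnd ℂ) (ip h₁ h₂))
  generalize Real.sqrt (P₁ * P₂) = s at *
  generalize ip h₁ h₂ = c at *
  generalize detHH h₁ h₂ = D at *
  refine ⟨fun hD hc => le_antisymm ?_ ?_, fun hD => le_antisymm ?_ ?_⟩
  · rw [key, le_div_iff₀ hD]
    nlinarith [sq_nonneg (s * D * ‖ρ₀‖ - ‖c‖), mul_le_mul_of_nonneg_left hre (mul_pos hs hD).le]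
  · have hsD : 0 < s * D := mul_pos hs hD
    have hn : ‖c / ((s * D : ℝ) : ℂ)‖ = ‖c‖ / (s * D) := by
      rw [norm_div, Complex.norm_real, Real.norm_of_nonneg hsD.le]
    have h := hmax (c / ((s * D : ℝ) : ℂ)) (by rw [hn]; exact div_le_one_of_le₀ hc hsD.le)
    have hk := key (c / ((s * D : ℝ) : ℂ))
    rw [hn, div_mul_eq_mul_div, Complex.mul_conj, ← Complex.ofReal_div, Complex.ofReal_re,
      Complex.normSq_eq_norm_sq] at hk
    have : 2 * s * (‖c‖ ^ 2 / (s * D)) - s ^ 2 * D * (‖c‖ / (s * D)) ^ 2 = ‖c‖ ^ 2 / D := by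
      field_simp
      ring
    linarith
  · rw [key, hD]
    nlinarith [mul_le_mul_of_nonneg_left hre hs.le,
      mul_le_mul_of_nonneg_left hρ₀ (mul_nonneg hs.le (norm_nonneg c))]
  · have h := hmax (c / (‖c‖ : ℂ)) (by simpa using div_self_le_one ‖c‖)
    have hk := key (c / (‖c‖ : ℂ))
    rw [hD, div_mul_eq_mul_div, Complex.mul_conj, ← Complex.ofReal_div, Complex.ofReal_re,
      Complex.normSq_eq_norm_sq, sq, mul_self_div_self] at hk
    linarith
end

section
/- (Parallel channel vectors.) Assume P₁ ≥ 0, P₂ ≥ 0, h₁ ≠ 0, and h₂ = c·h₁ for some c ∈ ℂ. Then for every ρ ∈ ℂ with |ρ| ≤ 1, det(I_N + H Q_r(ρ) H†) ≤ 1 + P₁‖h₁‖² + P₂‖h₂‖² + 2√(P₁P₂)·|h₁†h₂|, and equality holds at ρ = e^{i·arg(h₁†h₂)} (with the convention e^{i·arg(0)} = 1); that is, fully correlated relay signals are optimal. -/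
open Matrix Complex Filter

/-- For parallel channel vectors, `H Q_r(ρ) H†` has rank at most one and the determinant is
`1 + tr (H Q_r(ρ) H†)`. -/
theorem MACdet_of_parallel {N : ℕ} (h : Fin N → ℂ) (c : ℂ) (P₁ P₂ : ℝ) (ρ : ℂ) :
    MACdet h (fun i => c * h i) P₁ P₂ ρ =
      1 + P₁ * nsq h + P₂ * nsq (fun i => c * h i)
        + 2 * Real.sqrt (P₁ * P₂) *
          (ρ * (starRingEnd ℂ) (ip h fun i => c * h i)).re := by
  set s : ℝ := Real.sqrt (P₁ * P₂) with hs
  set α : ℂ := P₁ + ρ * s * (starRingEnd ℂ) c + (starRingEnd ℂ) ρ * s * c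
    + P₂ * (c * (starRingEnd ℂ) c) with hα
  have hmat : Hm h (fun i => c * h i) * Qr P₁ P₂ ρ * (Hm h (fun i => c * h i))ᴴ =
      replicateCol Unit (fun i => α * h i) *
        replicateRow Unit (fun i => (starRingEnd ℂ) (h i)) := by
    ext i j
    simp [Matrix.mul_apply, Fin.sum_univ_two, Hm, Qr, hα, ← hs]
    ring
  have hdot : (fun i => (starRingEnd ℂ) (h i)) ⬝ᵥ (fun i => α * h i) = α * (nsq h : ℂ) := by
    simp only [dotProduct, nsq, Complex.ofReal_sum, Finset.mul_sum]
    refine Finset.sum_congr rfl fun i _ => ?_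
    rw [← Complex.mul_conj]
    ring
  have hip : ip h (fun i => c * h i) = c * (nsq h : ℂ) := by
    simp only [ip, nsq, Complex.ofReal_sum, Finset.mul_sum]
    refine Finset.sum_congr rfl fun i _ => ?_
    rw [← Complex.mul_conj]
    ring
  have hnsq : nsq (fun i => c * h i) = Complex.normSq c * nsq h := by
    simp only [nsq, Complex.normSq_mul, Finset.mul_sum]
  rw [MACdet, hmat, det_one_add_replicateCol_mul_replicateRow, hdot, hip, hnsq, hα,
    Complex.mul_conj c]
  simp
  ring

/-- Parallel channel vectors. If `P₁, P₂ ≥ 0`, `h₁ ≠ 0` and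
`h₂ = c·h₁` for some `c ∈ ℂ`, then for every `ρ` with `|ρ| ≤ 1`,
`det (I_N + H Q_r(ρ) H†) ≤ 1 + P₁‖h₁‖² + P₂‖h₂‖² + 2√(P₁P₂)·|h₁†h₂|`, with equality
at `ρ = e^{i·arg(h₁†h₂)}` (with `e^{i·arg 0} = 1`): fully correlated signals are optimal. -/
theorem stmt9 {N : ℕ} (hN : 0 < N) (h₁ h₂ : Fin N → ℂ) (P₁ P₂ : ℝ)
    (hP₁ : 0 ≤ P₁) (hP₂ : 0 ≤ P₂) (hh₁ : h₁ ≠ 0)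
    (c : ℂ) (hc : h₂ = fun i => c * h₁ i) :
    (∀ ρ : ℂ, ‖ρ‖ ≤ 1 →
        MACdet h₁ h₂ P₁ P₂ ρ ≤
          1 + P₁ * nsq h₁ + P₂ * nsq h₂
            + 2 * Real.sqrt (P₁ * P₂) * ‖ip h₁ h₂‖) ∧
    MACdet h₁ h₂ P₁ P₂ (Complex.exp (Complex.I * ((ip h₁ h₂).arg : ℂ))) =
      1 + P₁ * nsq h₁ + P₂ * nsq h₂
        + 2 * Real.sqrt (P₁ * P₂) * ‖ip h₁ h₂‖ := by
  subst hc
  simp only [MACdet_of_parallel]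
  set z := ip h₁ fun i => c * h₁ i with hz
  refine ⟨fun ρ hρ => ?_, ?_⟩
  · gcongr
    calc (ρ * (starRingEnd ℂ) z).re ≤ ‖ρ * (starRingEnd ℂ) z‖ := Complex.re_le_norm _
      _ = ‖ρ‖ * ‖z‖ := by rw [norm_mul, Complex.norm_conj]
      _ ≤ ‖z‖ := mul_le_of_le_one_left (norm_nonneg z) hρ
  · set e := Complex.exp (Complex.I * (z.arg : ℂ)) with he
    have hpolar : (‖z‖ : ℂ) * e = z := by
      rw [he, mul_comm Complex.I]
      exact Complex.norm_mul_exp_arg_mul_I z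
    have hunit : e * (starRingEnd ℂ) e = 1 := by
      rw [Complex.mul_conj, Complex.normSq_eq_norm_sq, he, mul_comm Complex.I,
        Complex.norm_exp_ofReal_mul_I]
      simp
    have hmul : e * (starRingEnd ℂ) z = (‖z‖ : ℂ) := by
      conv_lhs => rw [← hpolar]
      rw [map_mul, Complex.conj_ofReal, mul_left_comm, hunit, mul_one]
    rw [hmul, Complex.ofReal_re]
end
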